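/- arXiv:2101.01388 — 9 statements merged into one kernel-verified Lean document; each statement's English description precedes it below -/
import Mathlib

section
/- Fix an integer N ≥ 2 and parameters γ > 0, σ > 0, μ ∈ ℝ, u ∈ ℝ. Suppose the liquidity demand is deterministic, ũ = u almost surely, and μ̃ ~ N(μ, σ²). Then a pair (a, b) ∈ ℝ × (0, ∞) is a symmetric Nash equilibrium of the demand-schedule game if and only if a/b = μ − (γσ²/N)u + ((N−2)/N)·(1/(b(N−1)))·u; consequently there is a one-to-one correspondence between symmetric equilibria and λ := 1/(b(N−1)) ∈ (0, ∞), and in equilibrium the clearing price is p = μ − (γσ²/N)u − (λ/N)u. -/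
open MeasureTheory ProbabilityTheory

/-- Clearing price received by a deviator who submits the affine demand schedule
`(α, β)` (committing to buy `α − βp` at price `p`) when the other `N − 1` market
makers all submit `(a, b)` and the realized liquidity quantity is `v`: it solves
`(N−1)(a − bp) + (α − βp) = v`. -/
noncomputable def clearingPrice (N : ℕ) (a b alpha beta v : ℝ) : ℝ :=
  ((N - 1 : ℝ) * a + alpha - v) / ((N - 1 : ℝ) * b + beta)

/-- Quantity received by the deviator at the clearing price. -/
noncomputable def clearingQty (N : ℕ) (a b alpha beta v : ℝ) : ℝ :=
  alpha - beta * clearingPrice N a b alpha beta v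

/-- `(a, b) ∈ ℝ × (0, ∞)` is a symmetric Nash equilibrium of the demand-schedule
game: when all `N` market makers play `(a, b)`, no market maker can strictly
increase her expected utility `E[−exp(−γ q(μ̃ − p))]` by unilaterally deviating to
any `(α, β) ∈ ℝ × (0, ∞)`.  Expected utilities are valued in `[−∞, 0)` via the
Lebesgue integral of the nonnegative integrand `exp(−γ q(μ̃ − p)) = exp(γ q(p − μ̃))`,
so the deviation utility is no larger than the equilibrium utility iff the
deviation lower integral is no smaller than the equilibrium one. -/
noncomputable def IsSymNE {Om : Type*} [MeasurableSpace Om] (P : Measure Om)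
    (N : ℕ) (gam : ℝ) (muRV ut : Om → ℝ) (a b : ℝ) : Prop :=
  0 < b ∧ ∀ alpha beta : ℝ, 0 < beta →
    (∫⁻ om, ENNReal.ofReal
        (Real.exp (gam * clearingQty N a b a b (ut om)
          * (clearingPrice N a b a b (ut om) - muRV om))) ∂P) ≤
    (∫⁻ om, ENNReal.ofReal
        (Real.exp (gam * clearingQty N a b alpha beta (ut om)
          * (clearingPrice N a b alpha beta (ut om) - muRV om))) ∂P)

/-- Exponential moment of an affine function of a Gaussian variable, as a lower integral. -/
lemma lintegral_exp_mul_sub_of_map_eq_gaussianReal {Om : Type*} [MeasurableSpace Om]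
    (P : Measure Om) [IsProbabilityMeasure P] (mu sig : ℝ) (X : Om → ℝ) (hX : Measurable X)
    (hgauss : P.map X = gaussianReal mu (Real.toNNReal (sig ^ 2))) (c p : ℝ) :
    ∫⁻ om, ENNReal.ofReal (Real.exp (c * (p - X om))) ∂P
      = ENNReal.ofReal (Real.exp (c * (p - mu) + sig ^ 2 * c ^ 2 / 2)) := by
  have hint : Integrable (fun om => Real.exp (-c * X om)) P := by
    have h := integrable_exp_mul_gaussianReal (μ := mu) (v := Real.toNNReal (sig ^ 2)) (-c)
    rw [← hgauss] at h
    exact h.comp_measurable hX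
  have hmgf : ∫ om, Real.exp (-c * X om) ∂P
      = Real.exp (mu * -c + Real.toNNReal (sig ^ 2) * (-c) ^ 2 / 2) :=
    mgf_gaussianReal hgauss (-c)
  have hexp : ∀ om, Real.exp (c * (p - X om)) = Real.exp (c * p) * Real.exp (-c * X om) := by
    intro om
    rw [← Real.exp_add]
    ring_nf
  simp_rw [hexp]
  rw [← ofReal_integral_eq_lintegral_ofReal (hint.const_mul _)
    (Filter.Eventually.of_forall fun om => by positivity), integral_const_mul, hmgf,
    ← Real.exp_add, Real.coe_toNNReal _ (sq_nonneg sig)]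
  ring_nf

/-- Mean-variance objective of a market maker who receives the quantity `clearingQty`. -/
lemma clearing_objective_sub (N : ℕ) (hN : 2 ≤ N) (g mu u a b alpha beta : ℝ)
    (hb : 0 < b) (hbeta : 0 < beta) :
    (clearingQty N a b alpha beta u * (clearingPrice N a b alpha beta u - mu)
        + g * clearingQty N a b alpha beta u ^ 2 / 2)
      - (clearingQty N a b a b u * (clearingPrice N a b a b u - mu)
        + g * clearingQty N a b a b u ^ 2 / 2)
      = (clearingQty N a b alpha beta u - u / N)
          * (a / b - (mu - g / N * u + ((N - 2 : ℝ) / N) * (1 / (b * (N - 1))) * u))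
        + (1 / (b * (N - 1)) + g / 2) * (clearingQty N a b alpha beta u - u / N) ^ 2 := by
  have hN' : (2 : ℝ) ≤ N := by exact_mod_cast hN
  have hN0 : (N : ℝ) ≠ 0 := by positivity
  have hM : (0 : ℝ) < N - 1 := by linarith
  have hp : clearingPrice N a b alpha beta u
      = (clearingQty N a b alpha beta u - u + (N - 1) * a) / ((N - 1) * b) := by
    have : ((N - 1 : ℝ) * b + beta) ≠ 0 := by positivity
    unfold clearingQty clearingPrice
    field_simp
    ring
  have hpe : clearingPrice N a b a b u = (a - u / N) / b := by
    have : ((N - 1 : ℝ) * b + b) ≠ 0 := by positivity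
    unfold clearingPrice
    field_simp
    ring
  have hqe : clearingQty N a b a b u = u / N := by
    rw [clearingQty, hpe]
    field_simp
    ring
  rw [hp, hqe, hpe]
  generalize clearingQty N a b alpha beta u = q
  have := hM.ne'
  field_simp
  ring

/-- Every quantity is attainable by some decreasing schedule. -/
lemma exists_clearingQty_eq (N : ℕ) (hN : 2 ≤ N) (a b u q : ℝ) (hb : 0 < b) :
    ∃ alpha : ℝ, clearingQty N a b alpha 1 u = q := by
  have hN' : (2 : ℝ) ≤ N := by exact_mod_cast hN
  have hM : (0 : ℝ) < N - 1 := by linarith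
  have : ((N - 1 : ℝ) * b + 1) ≠ 0 := by positivity
  refine ⟨q + (q - u + (N - 1) * a) / ((N - 1) * b), ?_⟩
  unfold clearingQty clearingPrice
  have := hM.ne'
  field_simp
  ring

/-- With `N ≥ 2` market makers, `γ, σ > 0`, deterministic liquidity demand `ũ = u` a.s.
and payoff `μ̃ ∼ N(μ, σ²)` independent of `ũ`, a pair `(a, b) ∈ ℝ × (0, ∞)` is a
symmetric Nash equilibrium iff `a/b = μ − (γσ²/N)u + ((N−2)/N)·(1/(b(N−1)))·u`;
consequently, in equilibrium the clearing price is
`p = μ − (γσ²/N)u − (λ/N)u` where `λ := 1/(b(N−1))`. -/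
theorem stmt_0 {Om : Type*} [MeasurableSpace Om] (P : Measure Om)
    [IsProbabilityMeasure P] (N : ℕ) (hN : 2 ≤ N)
    (gam sig : ℝ) (hgam : 0 < gam) (hsig : 0 < sig) (mu u : ℝ)
    (muRV ut : Om → ℝ) (hmuRV : Measurable muRV) (hut : Measurable ut)
    (hgauss : P.map muRV = gaussianReal mu (Real.toNNReal (sig ^ 2)))
    (hindep : IndepFun muRV ut P)
    (hdet : ∀ᵐ om ∂P, ut om = u) :
    ∀ a b : ℝ, 0 < b →
      (IsSymNE P N gam muRV ut a b ↔
        a / b = mu - gam * sig ^ 2 / N * u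
          + ((N - 2 : ℝ) / N) * (1 / (b * (N - 1))) * u) ∧
      (IsSymNE P N gam muRV ut a b →
        clearingPrice N a b a b u
          = mu - gam * sig ^ 2 / N * u - (1 / (b * (N - 1))) / N * u) := by
  intro a b hb
  have hN' : (2 : ℝ) ≤ N := by exact_mod_cast hN
  have hM : (0 : ℝ) < N - 1 := by linarith
  have hM0 := hM.ne'
  have hk : 0 < 1 / (b * (N - 1)) + gam * sig ^ 2 / 2 := by positivity
  have hval : ∀ alpha beta : ℝ,
      ∫⁻ om, ENNReal.ofReal (Real.exp (gam * clearingQty N a b alpha beta (ut om)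
          * (clearingPrice N a b alpha beta (ut om) - muRV om))) ∂P
        = ENNReal.ofReal (Real.exp (gam *
          (clearingQty N a b alpha beta u * (clearingPrice N a b alpha beta u - mu)
            + gam * sig ^ 2 * clearingQty N a b alpha beta u ^ 2 / 2))) := by
    intro alpha beta
    have hae : ∀ᵐ om ∂P,
        ENNReal.ofReal (Real.exp (gam * clearingQty N a b alpha beta (ut om)
          * (clearingPrice N a b alpha beta (ut om) - muRV om)))
        = ENNReal.ofReal (Real.exp (gam * clearingQty N a b alpha beta u
          * (clearingPrice N a b alpha beta u - muRV om))) := by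
      filter_upwards [hdet] with om hom
      rw [hom]
    rw [lintegral_congr_ae hae,
      lintegral_exp_mul_sub_of_map_eq_gaussianReal P mu sig muRV hmuRV hgauss]
    ring_nf
  have hiff : IsSymNE P N gam muRV ut a b ↔
      a / b = mu - gam * sig ^ 2 / N * u + ((N - 2 : ℝ) / N) * (1 / (b * (N - 1))) * u := by
    unfold IsSymNE
    simp only [hval, ENNReal.ofReal_le_ofReal_iff (Real.exp_pos _).le, Real.exp_le_exp,
      mul_le_mul_iff_right₀ hgam]
    constructor
    · rintro ⟨-, h⟩
      set F := a / b - (mu - gam * sig ^ 2 / N * u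
        + ((N - 2 : ℝ) / N) * (1 / (b * (N - 1))) * u) with hF
      set k := 1 / (b * (N - 1)) + gam * sig ^ 2 / 2 with hkdef
      obtain ⟨alpha, hq⟩ := exists_clearingQty_eq N hN a b u (u / N - F / (2 * k)) hb
      have hdiff := clearing_objective_sub N hN (gam * sig ^ 2) mu u a b alpha 1 hb one_pos
      have hle := sub_nonneg.mpr (h alpha 1 one_pos)
      rw [hdiff, hq, ← hF, ← hkdef] at hle
      have hcalc : (u / N - F / (2 * k) - u / N) * F + k * (u / N - F / (2 * k) - u / N) ^ 2
          = -(F ^ 2 / (4 * k)) := by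
        field_simp
        ring
      rw [hcalc] at hle
      have hF0 : F = 0 := by
        by_contra hne
        have : 0 < F ^ 2 / (4 * k) := by positivity
        linarith
      linarith
    · intro h
      refine ⟨hb, fun alpha beta hbeta => sub_nonneg.mp ?_⟩
      rw [clearing_objective_sub N hN (gam * sig ^ 2) mu u a b alpha beta hb hbeta, h, sub_self,
        mul_zero, zero_add]
      positivity
  refine ⟨hiff, fun h => ?_⟩
  have hp : clearingPrice N a b a b u = a / b - u / (N * b) := by
    have : ((N - 1 : ℝ) * b + b) ≠ 0 := by positivity
    unfold clearingPrice
    field_simp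
    ring
  rw [hp, hiff.mp h]
  field_simp
  ring
end

section
/- Fix an integer N ≥ 3 and parameters γ > 0, σ > 0, μ ∈ ℝ. Suppose μ̃ ~ N(μ, σ²), ũ is independent of μ̃, and ũ is not almost surely constant. Then the demand-schedule game has a unique symmetric Nash equilibrium, given by b = (N−2)/((N−1)γσ²) and a = bμ, and in equilibrium the clearing price is p = μ − (γσ²/N)ũ − (γσ²/(N(N−2)))ũ almost surely. -/
open MeasureTheory ProbabilityTheory

open Real in
/-- Integrating out a Gaussian payoff that is independent of the traded quantity and price. -/
theorem lintegral_exp_gaussian_indep {Om : Type*} [MeasurableSpace Om] (P : Measure Om)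
    [IsProbabilityMeasure P] (sig mu : ℝ) (muRV ut : Om → ℝ) (hmuRV : Measurable muRV)
    (hut : Measurable ut) (hgauss : P.map muRV = gaussianReal mu (Real.toNNReal (sig ^ 2)))
    (hindep : IndepFun muRV ut P) (g p : ℝ → ℝ) (hg : Measurable g) (hp : Measurable p) :
    ∫⁻ om, ENNReal.ofReal (exp (g (ut om) * (p (ut om) - muRV om))) ∂P =
      ∫⁻ om, ENNReal.ofReal
        (exp (g (ut om) * (p (ut om) - mu) + sig ^ 2 * g (ut om) ^ 2 / 2)) ∂P := by
  have hprod := (indepFun_iff_map_prod_eq_prod_map_map hmuRV.aemeasurable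
    hut.aemeasurable).1 hindep
  have hF : Measurable fun z : ℝ × ℝ => ENNReal.ofReal (exp (g z.2 * (p z.2 - z.1))) := by
    fun_prop
  have hG : Measurable fun v : ℝ =>
      ENNReal.ofReal (exp (g v * (p v - mu) + sig ^ 2 * g v ^ 2 / 2)) := by
    fun_prop
  have hinner (v : ℝ) : ∫⁻ x, ENNReal.ofReal (exp (g v * (p v - x))) ∂(P.map muRV) =
      ENNReal.ofReal (exp (g v * (p v - mu) + sig ^ 2 * g v ^ 2 / 2)) := by
    have hsplit (x : ℝ) : exp (g v * (p v - x)) = exp (g v * p v) * exp (-g v * x) := by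
      rw [← exp_add]; ring_nf
    rw [hgauss]
    simp_rw [hsplit]
    rw [← ofReal_integral_eq_lintegral_ofReal
      ((integrable_exp_mul_gaussianReal (-g v)).const_mul _)
      (ae_of_all _ fun x => by positivity), integral_const_mul]
    have hmgf := congrFun (mgf_id_gaussianReal (μ := mu) (v := Real.toNNReal (sig ^ 2))) (-g v)
    simp only [mgf, id, Real.coe_toNNReal _ (sq_nonneg sig)] at hmgf
    rw [hmgf, ← exp_add]
    ring_nf
  calc
    _ = ∫⁻ z, ENNReal.ofReal (exp (g z.2 * (p z.2 - z.1))) ∂(P.map fun om => (muRV om, ut om)) :=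
        (lintegral_map hF (hmuRV.prodMk hut)).symm
    _ = ∫⁻ v, ENNReal.ofReal (exp (g v * (p v - mu) + sig ^ 2 * g v ^ 2 / 2)) ∂(P.map ut) := by
        rw [hprod, lintegral_prod_symm _ hF.aemeasurable]
        simp_rw [hinner]
    _ = _ := lintegral_map hG hut

/-- The log conditional expected disutility of buying `q` on the residual supply curve of `N - 1`
opponents playing `(a, b)`, when the quantity to be cleared is `v`. -/
noncomputable def residualCost (N : ℕ) (gam sig mu a b v q : ℝ) : ℝ :=
  gam * q * (((N - 1 : ℝ) * a - v + q) / ((N - 1 : ℝ) * b) - mu) + sig ^ 2 * (gam * q) ^ 2 / 2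

/-- The minimizer of `residualCost` in `q`. -/
noncomputable def bestQty (N : ℕ) (gam sig mu a b v : ℝ) : ℝ :=
  (mu * ((N - 1 : ℝ) * b) - (N - 1 : ℝ) * a + v) / (2 + gam * sig ^ 2 * ((N - 1 : ℝ) * b))

theorem residualCost_eq {N : ℕ} (hN : 3 ≤ N) {gam sig b : ℝ} (hgam : 0 < gam) (hb : 0 < b)
    (mu a v q : ℝ) :
    residualCost N gam sig mu a b v q =
      residualCost N gam sig mu a b v (bestQty N gam sig mu a b v) +
        (gam / ((N - 1 : ℝ) * b) + gam ^ 2 * sig ^ 2 / 2) *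
          (q - bestQty N gam sig mu a b v) ^ 2 := by
  have hM : (0 : ℝ) < N - 1 := by
    have : (3 : ℝ) ≤ N := by exact_mod_cast hN
    linarith
  have hD : 0 < (N - 1 : ℝ) * b := by positivity
  unfold residualCost bestQty
  set D := (N - 1 : ℝ) * b
  have hE : 2 + gam * sig ^ 2 * D ≠ 0 := by positivity
  field_simp
  ring

theorem residualCost_bestQty_le {N : ℕ} (hN : 3 ≤ N) {gam sig b : ℝ} (hgam : 0 < gam)
    (hb : 0 < b) (mu a v q : ℝ) :
    residualCost N gam sig mu a b v (bestQty N gam sig mu a b v) ≤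
      residualCost N gam sig mu a b v q := by
  have hM : (0 : ℝ) < N - 1 := by
    have : (3 : ℝ) ≤ N := by exact_mod_cast hN
    linarith
  rw [residualCost_eq hN hgam hb mu a v q]
  have : 0 ≤ (gam / ((N - 1 : ℝ) * b) + gam ^ 2 * sig ^ 2 / 2) *
      (q - bestQty N gam sig mu a b v) ^ 2 := by positivity
  linarith

theorem residualCost_bestQty_nonpos {N : ℕ} (hN : 3 ≤ N) {gam sig b : ℝ} (hgam : 0 < gam)
    (hb : 0 < b) (mu a v : ℝ) :
    residualCost N gam sig mu a b v (bestQty N gam sig mu a b v) ≤ 0 := by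
  simpa [residualCost] using residualCost_bestQty_le (sig := sig) hN hgam hb mu a v 0

theorem clearingPrice_eq_residual {N : ℕ} (hN : 3 ≤ N) {b beta : ℝ} (hb : 0 < b)
    (hbeta : 0 < beta) (a alpha v : ℝ) :
    clearingPrice N a b alpha beta v =
      ((N - 1 : ℝ) * a - v + clearingQty N a b alpha beta v) / ((N - 1 : ℝ) * b) := by
  have hM : (0 : ℝ) < N - 1 := by
    have : (3 : ℝ) ≤ N := by exact_mod_cast hN
    linarith
  have hE : (N - 1 : ℝ) * b + beta ≠ 0 := by positivity
  unfold clearingQty clearingPrice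
  field_simp
  ring

theorem clearingQty_symm {N : ℕ} (hN : 3 ≤ N) {b : ℝ} (hb : 0 < b) (a v : ℝ) :
    clearingQty N a b a b v = v / N := by
  have h0 : (0 : ℝ) < N := by positivity
  have hE : (N - 1 : ℝ) * b + b = N * b := by ring
  unfold clearingQty clearingPrice
  rw [hE]
  field_simp
  ring

theorem clearingQty_bestResponse {N : ℕ} (hN : 3 ≤ N) {gam sig b : ℝ} (hgam : 0 < gam)
    (hb : 0 < b) (mu a v : ℝ) :
    clearingQty N a b
        ((N - 1 : ℝ) * b / (1 + gam * sig ^ 2 * ((N - 1 : ℝ) * b)) * mu)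
        ((N - 1 : ℝ) * b / (1 + gam * sig ^ 2 * ((N - 1 : ℝ) * b))) v =
      bestQty N gam sig mu a b v := by
  have hM : (0 : ℝ) < N - 1 := by
    have : (3 : ℝ) ≤ N := by exact_mod_cast hN
    linarith
  have hD : 0 < (N - 1 : ℝ) * b := by positivity
  unfold clearingQty clearingPrice bestQty
  set D := (N - 1 : ℝ) * b
  have hE : 2 + gam * sig ^ 2 * D ≠ 0 := by positivity
  have hE1 : 1 + gam * sig ^ 2 * D ≠ 0 := by positivity
  have hE2 : D + D / (1 + gam * sig ^ 2 * D) =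
      D * (2 + gam * sig ^ 2 * D) / (1 + gam * sig ^ 2 * D) := by
    field_simp
    ring
  rw [hE2]
  field_simp
  ring

theorem lintegral_exp_clearing {Om : Type*} [MeasurableSpace Om] (P : Measure Om)
    [IsProbabilityMeasure P] {N : ℕ} (hN : 3 ≤ N) (gam sig mu : ℝ)
    (muRV ut : Om → ℝ) (hmuRV : Measurable muRV) (hut : Measurable ut)
    (hgauss : P.map muRV = gaussianReal mu (Real.toNNReal (sig ^ 2)))
    (hindep : IndepFun muRV ut P) {b beta : ℝ} (hb : 0 < b) (hbeta : 0 < beta) (a alpha : ℝ) :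
    ∫⁻ om, ENNReal.ofReal (Real.exp (gam * clearingQty N a b alpha beta (ut om)
        * (clearingPrice N a b alpha beta (ut om) - muRV om))) ∂P =
      ∫⁻ om, ENNReal.ofReal (Real.exp (residualCost N gam sig mu a b (ut om)
        (clearingQty N a b alpha beta (ut om)))) ∂P := by
  rw [lintegral_exp_gaussian_indep P sig mu muRV ut hmuRV hut hgauss hindep
    (fun v => gam * clearingQty N a b alpha beta v) (clearingPrice N a b alpha beta)
    (by unfold clearingQty clearingPrice; fun_prop) (by unfold clearingPrice; fun_prop)]
  refine lintegral_congr fun om => ?_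
  rw [clearingPrice_eq_residual hN hb hbeta, residualCost]

/-- The symmetric quantity `v / N` is the best reply at `v` for every `v` in equilibrium. -/
theorem bestQty_equilibrium {N : ℕ} (hN : 3 ≤ N) {gam sig b : ℝ} (hgam : 0 < gam)
    (hsig : 0 < sig) (hb : b = (N - 2 : ℝ) / ((N - 1 : ℝ) * gam * sig ^ 2)) (mu v : ℝ) :
    bestQty N gam sig mu (b * mu) b v = v / N := by
  have h3 : (3 : ℝ) ≤ N := by exact_mod_cast hN
  have hM : (N - 1 : ℝ) ≠ 0 := by linarith
  have hden : 2 + gam * sig ^ 2 * ((N - 1 : ℝ) * b) = N := by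
    rw [hb]
    field_simp
    ring
  rw [bestQty, hden]
  ring

/-- If `v / N` is the best reply at two distinct values of `v`, the strategy is the equilibrium. -/
theorem eq_of_bestQty_eq {N : ℕ} (hN : 3 ≤ N) {gam sig b : ℝ} (hgam : 0 < gam)
    (hsig : 0 < sig) (hb : 0 < b) {mu a v w : ℝ} (hvw : v ≠ w)
    (hv : v / N = bestQty N gam sig mu a b v) (hw : w / N = bestQty N gam sig mu a b w) :
    b = (N - 2 : ℝ) / ((N - 1 : ℝ) * gam * sig ^ 2) ∧ a = b * mu := by
  have h3 : (3 : ℝ) ≤ N := by exact_mod_cast hN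
  have h0 : (0 : ℝ) < N := by linarith
  have hM : (0 : ℝ) < N - 1 := by linarith
  have hE : 0 < 2 + gam * sig ^ 2 * ((N - 1 : ℝ) * b) := by positivity
  rw [bestQty, div_eq_div_iff h0.ne' hE.ne'] at hv hw
  have hslope : 2 + gam * sig ^ 2 * ((N - 1 : ℝ) * b) = N :=
    mul_left_cancel₀ (sub_ne_zero.2 hvw) (by linear_combination hv - hw)
  refine ⟨?_, ?_⟩
  · rw [eq_div_iff (by positivity)]
    linear_combination hslope
  · rw [hslope] at hv
    refine mul_left_cancel₀ (mul_pos h0 hM).ne' ?_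
    linear_combination hv

/-- With `N ≥ 3` market makers, `γ, σ > 0`, payoff `μ̃ ∼ N(μ, σ²)` and liquidity demand
`ũ` independent of `μ̃` and not a.s. constant, the demand-schedule game has a unique
symmetric Nash equilibrium, given by `b = (N−2)/((N−1)γσ²)` and `a = bμ`; in
equilibrium the clearing price is
`p = μ − (γσ²/N)ũ − (γσ²/(N(N−2)))ũ` almost surely. -/
theorem stmt_1 {Om : Type*} [MeasurableSpace Om] (P : Measure Om)
    [IsProbabilityMeasure P] (N : ℕ) (hN : 3 ≤ N)
    (gam sig : ℝ) (hgam : 0 < gam) (hsig : 0 < sig) (mu : ℝ)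
    (muRV ut : Om → ℝ) (hmuRV : Measurable muRV) (hut : Measurable ut)
    (hgauss : P.map muRV = gaussianReal mu (Real.toNNReal (sig ^ 2)))
    (hindep : IndepFun muRV ut P)
    (hnc : ¬ ∃ c : ℝ, ∀ᵐ om ∂P, ut om = c) :
    (∀ a b : ℝ, IsSymNE P N gam muRV ut a b ↔
      (b = (N - 2 : ℝ) / ((N - 1 : ℝ) * gam * sig ^ 2) ∧ a = b * mu)) ∧
    (∀ᵐ om ∂P,
      clearingPrice N
          (((N - 2 : ℝ) / ((N - 1 : ℝ) * gam * sig ^ 2)) * mu)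
          ((N - 2 : ℝ) / ((N - 1 : ℝ) * gam * sig ^ 2))
          (((N - 2 : ℝ) / ((N - 1 : ℝ) * gam * sig ^ 2)) * mu)
          ((N - 2 : ℝ) / ((N - 1 : ℝ) * gam * sig ^ 2)) (ut om)
        = mu - gam * sig ^ 2 / N * ut om
          - gam * sig ^ 2 / (N * (N - 2 : ℝ)) * ut om) := by
  have h3 : (3 : ℝ) ≤ N := by exact_mod_cast hN
  have hM : (0 : ℝ) < N - 1 := by linarith
  have hM2 : (0 : ℝ) < N - 2 := by linarith
  refine ⟨fun a b => ⟨fun ⟨hb, hopt⟩ => ?_, fun ⟨hb, ha⟩ => ?_⟩, ae_of_all _ fun om => ?_⟩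
  · have hbeta : 0 < (N - 1 : ℝ) * b / (1 + gam * sig ^ 2 * ((N - 1 : ℝ) * b)) := by positivity
    have hle := hopt ((N - 1 : ℝ) * b / (1 + gam * sig ^ 2 * ((N - 1 : ℝ) * b)) * mu) _ hbeta
    rw [lintegral_exp_clearing P hN gam sig mu muRV ut hmuRV hut hgauss hindep hb hb,
      lintegral_exp_clearing P hN gam sig mu muRV ut hmuRV hut hgauss hindep hb hbeta] at hle
    simp only [clearingQty_symm hN hb, clearingQty_bestResponse hN hgam hb] at hle
    have hfin : ∫⁻ om, ENNReal.ofReal (Real.exp (residualCost N gam sig mu a b (ut om)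
        (bestQty N gam sig mu a b (ut om)))) ∂P ≠ ⊤ := by
      refine ne_top_of_le_ne_top ENNReal.one_ne_top ?_
      calc
        _ ≤ ∫⁻ _, 1 ∂P := lintegral_mono fun om => by
            rw [ENNReal.ofReal_le_one, Real.exp_le_one_iff]
            exact residualCost_bestQty_nonpos hN hgam hb mu a _
        _ = 1 := by simp
    have hae := ae_eq_of_ae_le_of_lintegral_le
      (ae_of_all P fun om => ENNReal.ofReal_le_ofReal (Real.exp_le_exp.2
        (residualCost_bestQty_le (sig := sig) hN hgam hb mu a (ut om) (ut om / N)))) hfin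
      (by unfold residualCost; fun_prop) hle
    have hqty : ∀ᵐ om ∂P, ut om / N = bestQty N gam sig mu a b (ut om) := by
      filter_upwards [hae] with om hom
      rw [ENNReal.ofReal_eq_ofReal_iff (Real.exp_pos _).le (Real.exp_pos _).le,
        Real.exp_eq_exp, residualCost_eq hN hgam hb mu a (ut om) (ut om / N),
        left_eq_add, mul_eq_zero] at hom
      have hK : gam / ((N - 1 : ℝ) * b) + gam ^ 2 * sig ^ 2 / 2 ≠ 0 := by positivity
      exact sub_eq_zero.1 (pow_eq_zero_iff two_ne_zero |>.1 (hom.resolve_left hK))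
    obtain ⟨om₀, hom₀⟩ := hqty.exists
    by_contra hne
    refine hnc ⟨ut om₀, ?_⟩
    filter_upwards [hqty] with om hom
    by_contra hvw
    exact hne (eq_of_bestQty_eq hN hgam hsig hb hvw hom hom₀)
  · have hb0 : 0 < b := by rw [hb]; positivity
    refine ⟨hb0, fun alpha beta hbeta => ?_⟩
    rw [lintegral_exp_clearing P hN gam sig mu muRV ut hmuRV hut hgauss hindep hb0 hb0,
      lintegral_exp_clearing P hN gam sig mu muRV ut hmuRV hut hgauss hindep hb0 hbeta]
    refine lintegral_mono fun om => ENNReal.ofReal_le_ofReal (Real.exp_le_exp.2 ?_)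
    rw [clearingQty_symm hN hb0, ha, ← bestQty_equilibrium hN hgam hsig hb mu (ut om)]
    exact residualCost_bestQty_le hN hgam hb0 mu _ _ _
  · set c : ℝ := (N - 2 : ℝ) / ((N - 1 : ℝ) * gam * sig ^ 2) with hc
    have hE : (N - 1 : ℝ) * c + c = N * c := by ring
    rw [clearingPrice, hE, hc]
    field_simp
    ring
end

section
/- Fix N = 2 and parameters γ > 0, σ > 0, μ ∈ ℝ. Suppose μ̃ ~ N(μ, σ²), ũ is independent of μ̃, and ũ is not almost surely constant. Then the demand-schedule game with two market makers admits no symmetric Nash equilibrium. -/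
open MeasureTheory ProbabilityTheory

/-- The expected exponential of an affine function of a Gaussian variable, as a Lebesgue integral. -/
lemma lintegral_exp_mul_sub_gaussianReal (m : ℝ) (v : NNReal) (t p : ℝ) :
    ∫⁻ x, ENNReal.ofReal (Real.exp (t * (p - x))) ∂(gaussianReal m v) =
      ENNReal.ofReal (Real.exp (t * (p - m) + v * t ^ 2 / 2)) := by
  have hexp : ∀ x : ℝ, Real.exp (t * (p - x)) = Real.exp (t * p) * Real.exp (-t * x) := fun x => by
    rw [← Real.exp_add]; ring_nf
  have hint : Integrable (fun x => Real.exp (t * (p - x))) (gaussianReal m v) := by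
    simp_rw [hexp]
    exact (integrable_exp_mul_gaussianReal (-t)).const_mul _
  rw [← ofReal_integral_eq_lintegral_ofReal hint (ae_of_all _ fun x => (Real.exp_pos _).le)]
  have hmgf := congrFun (mgf_id_gaussianReal (μ := m) (v := v)) (-t)
  simp only [mgf, id] at hmgf
  simp_rw [hexp]
  rw [integral_const_mul, hmgf, ← Real.exp_add]
  ring_nf

/-- Integrating out a Gaussian payoff that is independent of the traded quantity and the price. -/
lemma lintegral_exp_gaussian_of_indepFun {Om : Type*} [MeasurableSpace Om] {P : Measure Om}
    [IsProbabilityMeasure P] {X Y : Om → ℝ} (hX : Measurable X) (hY : Measurable Y)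
    (hindep : IndepFun X Y P) {m : ℝ} {v : NNReal} (hgauss : P.map X = gaussianReal m v)
    {t p : ℝ → ℝ} (ht : Measurable t) (hp : Measurable p) :
    ∫⁻ om, ENNReal.ofReal (Real.exp (t (Y om) * (p (Y om) - X om))) ∂P =
      ∫⁻ om, ENNReal.ofReal
        (Real.exp (t (Y om) * (p (Y om) - m) + v * t (Y om) ^ 2 / 2)) ∂P := by
  have hprod := (indepFun_iff_map_prod_eq_prod_map_map hX.aemeasurable hY.aemeasurable).1 hindep
  have hYprob : IsProbabilityMeasure (P.map Y) := Measure.isProbabilityMeasure_map hY.aemeasurable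
  have hmeas : Measurable fun z : ℝ × ℝ =>
      ENNReal.ofReal (Real.exp (t z.2 * (p z.2 - z.1))) := by fun_prop
  calc _ = ∫⁻ z, ENNReal.ofReal (Real.exp (t z.2 * (p z.2 - z.1)))
        ∂(P.map fun om => (X om, Y om)) := (lintegral_map hmeas (hX.prodMk hY)).symm
    _ = ∫⁻ y, ENNReal.ofReal (Real.exp (t y * (p y - m) + v * t y ^ 2 / 2)) ∂(P.map Y) := by
      rw [hprod, hgauss, lintegral_prod_symm _ hmeas.aemeasurable]
      simp_rw [lintegral_exp_mul_sub_gaussianReal]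
    _ = _ := lintegral_map (by fun_prop) hY

lemma measurable_clearingPrice (N : ℕ) (a b alpha beta : ℝ) :
    Measurable (clearingPrice N a b alpha beta) := by
  unfold clearingPrice; fun_prop

lemma measurable_clearingQty (N : ℕ) (a b alpha beta : ℝ) :
    Measurable (clearingQty N a b alpha beta) :=
  ((measurable_clearingPrice N a b alpha beta).const_mul beta).const_sub alpha

/-- With two market makers, the certainty-equivalent exponent of a deviator is a quadratic in her
quantity, minimized at `(v - a + b * m) / (2 + b * gam * s)`. -/
lemma exponent_eq_sq_sub_sq {gam s b beta : ℝ} (hgam : 0 < gam) (hs : 0 < s) (hb : 0 < b)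
    (hbeta : 0 < beta) (m a alpha v : ℝ) :
    gam * clearingQty 2 a b alpha beta v * (clearingPrice 2 a b alpha beta v - m)
        + s * (gam * clearingQty 2 a b alpha beta v) ^ 2 / 2 =
      gam / (2 * b) * (2 + b * gam * s) *
        ((clearingQty 2 a b alpha beta v - (v - a + b * m) / (2 + b * gam * s)) ^ 2
          - ((v - a + b * m) / (2 + b * gam * s)) ^ 2) := by
  have hD : 2 + b * gam * s ≠ 0 := by positivity
  have hsum : b + beta ≠ 0 := by positivity
  have hp : clearingPrice 2 a b alpha beta v =
      (clearingQty 2 a b alpha beta v + a - v) / b := by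
    unfold clearingQty clearingPrice
    push_cast
    norm_num
    field_simp
    ring
  rw [hp]
  field_simp
  ring

/-- Submitting `(beta * m, beta)` with `beta = b / (1 + b * gam * s)` attains the pointwise optimal
quantity. -/
lemma clearingQty_best_response {gam s b : ℝ} (hgam : 0 < gam) (hs : 0 < s) (hb : 0 < b)
    (m a v : ℝ) :
    clearingQty 2 a b (b / (1 + b * gam * s) * m) (b / (1 + b * gam * s)) v =
      (v - a + b * m) / (2 + b * gam * s) := by
  have hD : 2 + b * gam * s ≠ 0 := by positivity
  have hD' : 1 + b * gam * s ≠ 0 := by positivity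
  have hsum : b + b / (1 + b * gam * s) = b * (2 + b * gam * s) / (1 + b * gam * s) := by
    field_simp; ring
  unfold clearingQty clearingPrice
  push_cast
  norm_num
  rw [hsum]
  field_simp
  ring

lemma clearingQty_two_symm {a b : ℝ} (hb : 0 < b) (v : ℝ) : clearingQty 2 a b a b v = v / 2 := by
  unfold clearingQty clearingPrice
  push_cast
  norm_num
  field_simp
  ring

/-- With `N = 2` market makers, `γ, σ > 0`, payoff `μ̃ ∼ N(μ, σ²)` and liquidity demand
`ũ` independent of `μ̃` and not a.s. constant, the demand-schedule game admits no
symmetric Nash equilibrium. -/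
theorem stmt_2 {Om : Type*} [MeasurableSpace Om] (P : Measure Om)
    [IsProbabilityMeasure P]
    (gam sig : ℝ) (hgam : 0 < gam) (hsig : 0 < sig) (mu : ℝ)
    (muRV ut : Om → ℝ) (hmuRV : Measurable muRV) (hut : Measurable ut)
    (hgauss : P.map muRV = gaussianReal mu (Real.toNNReal (sig ^ 2)))
    (hindep : IndepFun muRV ut P)
    (hnc : ¬ ∃ c : ℝ, ∀ᵐ om ∂P, ut om = c) :
    ∀ a b : ℝ, ¬ IsSymNE P 2 gam muRV ut a b := by
  rintro a b ⟨hb, hdev⟩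
  have hs : 0 < sig ^ 2 := by positivity
  set s := sig ^ 2
  have hbeta : 0 < b / (1 + b * gam * s) := by positivity
  have key := hdev (b / (1 + b * gam * s) * mu) _ hbeta
  have reduce := fun alpha beta : ℝ =>
    lintegral_exp_gaussian_of_indepFun hmuRV hut hindep hgauss
      ((measurable_clearingQty 2 a b alpha beta).const_mul gam)
      (measurable_clearingPrice 2 a b alpha beta)
  rw [reduce, reduce, Real.coe_toNNReal s hs.le] at key
  simp_rw [exponent_eq_sq_sub_sq hgam hs hb hb, exponent_eq_sq_sub_sq hgam hs hb hbeta,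
    clearingQty_best_response hgam hs hb, clearingQty_two_symm hb] at key
  have hC : 0 < gam / (2 * b) * (2 + b * gam * s) := by positivity
  refine key.not_gt (lintegral_strict_mono_of_ae_le_of_frequently_ae_lt (by fun_prop) ?_ ?_ ?_)
  · refine ((lintegral_mono fun om => ?_).trans_lt
      (by simp : ∫⁻ _, (1 : ENNReal) ∂P < ⊤)).ne
    rw [ENNReal.ofReal_le_one, Real.exp_le_one_iff]
    refine mul_nonpos_of_nonneg_of_nonpos hC.le ?_
    nlinarith [sq_nonneg ((ut om - a + b * mu) / (2 + b * gam * s))]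
  · refine ae_of_all _ fun om => ?_
    refine ENNReal.ofReal_le_ofReal (Real.exp_le_exp.2 (mul_le_mul_of_nonneg_left ?_ hC.le))
    gcongr ?_ - _
    simpa using sq_nonneg _
  · intro hae
    refine hnc ⟨2 * (b * mu - a) / (b * gam * s), hae.mono fun om hom => ?_⟩
    have hle := (not_not.1 hom).ge
    rw [ENNReal.ofReal_le_ofReal_iff (Real.exp_pos _).le, Real.exp_le_exp,
      mul_le_mul_iff_right₀ hC] at hle
    have hzero : ut om / 2 - (ut om - a + b * mu) / (2 + b * gam * s) = 0 :=
      pow_eq_zero_iff two_ne_zero |>.1 (le_antisymm (by linarith) (sq_nonneg _))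
    have hD : 2 + b * gam * s ≠ 0 := by positivity
    field_simp at hzero ⊢
    linarith
end

section
/- Let ũ be a real random variable that is not almost surely constant, and fix an integer N ≥ 2, γ > 0, σ > 0, λ > 0, μ, F ∈ ℝ. Then the identity ũ/N = (μ − F)/(2λ + γσ²) + (λ/(2λ + γσ²))ũ holds almost surely if and only if F = μ and (N − 2)λ = γσ². In particular, if N = 2 then no F ∈ ℝ and λ > 0 satisfy the identity, and if N ≥ 3 the unique solution is F = μ, λ = γσ²/(N − 2). -/
open MeasureTheory

/-- An affine identity between a random variable that is not a.s. constant and itself forces the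
intercept to vanish and the slopes to agree. -/
theorem ae_mul_eq_add_mul_iff {Om : Type*} [MeasurableSpace Om] {P : Measure Om} {u : Om → ℝ}
    (hu : ¬ ∃ c : ℝ, ∀ᵐ om ∂P, u om = c) (a b c : ℝ) :
    (∀ᵐ om ∂P, a * u om = b + c * u om) ↔ b = 0 ∧ a = c := by
  constructor
  · intro h
    have hac : a = c := by
      by_contra hne
      have hsub : a - c ≠ 0 := sub_ne_zero.mpr hne
      refine hu ⟨b / (a - c), ?_⟩
      filter_upwards [h] with om hom
      rw [eq_div_iff hsub]
      linarith
    subst hac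
    refine ⟨?_, rfl⟩
    by_contra hb
    refine hu ⟨0, ?_⟩
    filter_upwards [h] with om hom
    exact absurd (by linarith) hb
  · rintro ⟨rfl, rfl⟩
    simp

/-- Let `ũ` be a real random variable that is not a.s. constant, `N ≥ 2` an integer,
`γ, σ, λ > 0`, `μ, F ∈ ℝ`.  Then the symmetric-equilibrium identity
`ũ/N = (μ − F)/(2λ + γσ²) + (λ/(2λ + γσ²))ũ` holds almost surely iff `F = μ` and
`(N − 2)λ = γσ²`.  In particular, if `N = 2` the identity fails, and if `N ≥ 3`
it holds iff `F = μ` and `λ = γσ²/(N − 2)`. -/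
theorem stmt_6 {Om : Type*} [MeasurableSpace Om] (P : Measure Om)
    [IsProbabilityMeasure P] (ut : Om → ℝ)
    (hnc : ¬ ∃ c : ℝ, ∀ᵐ om ∂P, ut om = c)
    (N : ℕ) (hN : 2 ≤ N) (gam sig lam mu F : ℝ)
    (hgam : 0 < gam) (hsig : 0 < sig) (hlam : 0 < lam) :
    ((∀ᵐ om ∂P, ut om / N = (mu - F) / (2 * lam + gam * sig ^ 2)
        + (lam / (2 * lam + gam * sig ^ 2)) * ut om)
      ↔ (F = mu ∧ (N - 2 : ℝ) * lam = gam * sig ^ 2)) ∧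
    (N = 2 → ¬ (∀ᵐ om ∂P, ut om / N = (mu - F) / (2 * lam + gam * sig ^ 2)
        + (lam / (2 * lam + gam * sig ^ 2)) * ut om)) ∧
    (3 ≤ N → ((∀ᵐ om ∂P, ut om / N = (mu - F) / (2 * lam + gam * sig ^ 2)
        + (lam / (2 * lam + gam * sig ^ 2)) * ut om)
      ↔ (F = mu ∧ lam = gam * sig ^ 2 / (N - 2 : ℝ)))) := by
  have hden : 0 < 2 * lam + gam * sig ^ 2 := by positivity
  have hNpos : (0 : ℝ) < N := by exact_mod_cast (by omega : 0 < N)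
  have key : (∀ᵐ om ∂P, ut om / N = (mu - F) / (2 * lam + gam * sig ^ 2)
        + (lam / (2 * lam + gam * sig ^ 2)) * ut om)
      ↔ (F = mu ∧ (N - 2 : ℝ) * lam = gam * sig ^ 2) := by
    simp only [div_eq_inv_mul (ut _)]
    rw [ae_mul_eq_add_mul_iff hnc]
    refine and_congr ?_ ?_
    · rw [div_eq_zero_iff, or_iff_left hden.ne', sub_eq_zero, eq_comm]
    · rw [inv_eq_one_div, div_eq_div_iff hNpos.ne' hden.ne']
      constructor <;> intro h <;> linarith
  refine ⟨key, fun hN2 => ?_, fun hN3 => ?_⟩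
  · rw [key]
    rintro ⟨-, h⟩
    subst hN2
    have : 0 < gam * sig ^ 2 := by positivity
    push_cast at h
    linarith
  · have hN3' : (3 : ℝ) ≤ N := by exact_mod_cast hN3
    rw [key, eq_div_iff (by linarith : (0 : ℝ) < N - 2).ne', mul_comm lam]
end

section
/- Let ũ be a real random variable that is not almost surely constant, and fix an integer N ≥ 3, γ > 0, σ > 0, λ > 0, and μ, F, C, S ∈ ℝ. Then the identity (C/λ)(x − S/N) + ũ/N = (μ − F − CS)/(2λ + γσ²) + ((C − γσ²)/(2λ + γσ²))x + (λ/(2λ + γσ²))ũ holds almost surely for every x ∈ ℝ if and only if F = μ, C = −γσ²/(N − 1), and λ = γσ²/(N − 2). -/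
open MeasureTheory

/-- Two affine functions of a random variable that is not almost surely constant agree almost
surely only if their coefficients agree. -/
theorem affine_coeff_eq_of_ae_eq {Om : Type*} [MeasurableSpace Om] {P : Measure Om}
    [IsProbabilityMeasure P] {u : Om → ℝ} (hnc : ¬ ∃ c : ℝ, ∀ᵐ om ∂P, u om = c)
    {a b a' b' : ℝ} (h : ∀ᵐ om ∂P, a + b * u om = a' + b' * u om) : a = a' ∧ b = b' := by
  have hb : b = b' := by
    by_contra hne
    have hsub : b - b' ≠ 0 := sub_ne_zero.mpr hne
    refine hnc ⟨(a' - a) / (b - b'), ?_⟩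
    filter_upwards [h] with om hom
    rw [eq_div_iff hsub]
    linarith
  subst hb
  obtain ⟨om, hom⟩ := h.exists
  exact ⟨add_right_cancel hom, rfl⟩

/-- Let `ũ` be a real random variable that is not a.s. constant, `N ≥ 3` an integer,
`γ, σ, λ > 0`, `μ, F, C, S ∈ ℝ`.  The linear symmetric equilibrium condition
`(C/λ)(x − S/N) + ũ/N = (μ − F − CS)/(2λ + γσ²) + ((C − γσ²)/(2λ + γσ²))x
+ (λ/(2λ + γσ²))ũ` holds almost surely for every `x ∈ ℝ` iff `F = μ`,
`C = −γσ²/(N − 1)` and `λ = γσ²/(N − 2)`. -/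
theorem stmt_7 {Om : Type*} [MeasurableSpace Om] (P : Measure Om)
    [IsProbabilityMeasure P] (ut : Om → ℝ)
    (hnc : ¬ ∃ c : ℝ, ∀ᵐ om ∂P, ut om = c)
    (N : ℕ) (hN : 3 ≤ N) (gam sig lam mu F C S : ℝ)
    (hgam : 0 < gam) (hsig : 0 < sig) (hlam : 0 < lam) :
    (∀ x : ℝ, ∀ᵐ om ∂P,
        (C / lam) * (x - S / N) + ut om / N
          = (mu - F - C * S) / (2 * lam + gam * sig ^ 2)
            + ((C - gam * sig ^ 2) / (2 * lam + gam * sig ^ 2)) * x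
            + (lam / (2 * lam + gam * sig ^ 2)) * ut om)
      ↔ (F = mu ∧ C = -(gam * sig ^ 2) / (N - 1 : ℝ)
          ∧ lam = gam * sig ^ 2 / (N - 2 : ℝ)) := by
  have hN' : (3 : ℝ) ≤ N := by exact_mod_cast hN
  have hN0 : (N : ℝ) ≠ 0 := by linarith
  have hN1 : (N : ℝ) - 1 ≠ 0 := by linarith
  have hN2 : (N : ℝ) - 2 ≠ 0 := by linarith
  have ha : 0 < gam * sig ^ 2 := by positivity
  generalize gam * sig ^ 2 = a at ha ⊢
  have hD0 : 2 * lam + a ≠ 0 := by positivity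
  constructor
  · intro h
    have coeff (x : ℝ) : (C / lam) * (x - S / N)
        = (mu - F - C * S) / (2 * lam + a) + ((C - a) / (2 * lam + a)) * x
          ∧ 1 / (N : ℝ) = lam / (2 * lam + a) := by
      refine affine_coeff_eq_of_ae_eq hnc ?_
      filter_upwards [h x] with om hom
      rw [← hom]
      ring
    obtain ⟨h0, hslope⟩ := coeff 0
    have h1 := (coeff 1).1
    have hD : 2 * lam + a = N * lam := by
      rw [div_eq_div_iff hN0 hD0] at hslope
      linarith
    rw [hD] at h0 h1
    field_simp at h0 h1
    have hF : F = mu := by linarith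
    refine ⟨hF, ?_, ?_⟩
    · rw [eq_div_iff hN1]
      linarith
    · rw [eq_div_iff hN2]
      linarith
  · rintro ⟨rfl, hC, hl⟩ x
    rw [eq_div_iff hN1] at hC
    rw [eq_div_iff hN2] at hl
    have hD : 2 * lam + a = N * lam := by linarith
    have hCa : C - a = C * N := by linarith
    refine Filter.Eventually.of_forall fun om => ?_
    rw [hD, hCa]
    field_simp
    ring
end

section
/- Fix an integer N ≥ 3 and parameters γ > 0, σ > 0, μ, S ∈ ℝ. Let μ̃ ~ N(μ, σ²) and let ũ be a real random variable independent of μ̃ that is not almost surely constant. Then there is a unique triple (a, ξ, b) ∈ ℝ × ℝ × (0, ∞) with the following best-response property: for every x ∈ ℝ and every (α, β) ∈ ℝ × (0, ∞), the expected utility E[−exp(−γ((x + q)μ̃ − pq))] — where p and q solve (a/(N−1))(S − x) + ξ − bp = (ũ − q)/(N−1) and α − βp = q — is maximized over (α, β) at (α, β) = (ax + ξ, b). This unique triple is given by b = (N−2)/((N−1)γσ²), a = −bγσ², ξ = bμ; under the corresponding linear symmetric profile the clearing price is p = μ − (γσ²/N)S − ((N−1)/(N(N−2)))γσ²ũ and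 market maker n's trade is qⁿ = −((N−2)/(N−1))(Xⁿ − S/N) + ũ/N, where Xⁿ is her initial inventory. -/
open MeasureTheory ProbabilityTheory

/-- Clearing price faced by a market maker with inventory `x` who submits the
demand schedule `(α, β)` while each of the other `N − 1` market makers (whose
aggregate inventory is `S − x`) plays the linear strategy `X ↦ (aX + ξ, b)`, and
the realized liquidity quantity is `v`.  Together with `q = α − βp`, it solves
`(a/(N−1))(S − x) + ξ − bp = (v − q)/(N−1)`. -/
noncomputable def invPrice (N : ℕ) (a xi b S x alpha beta v : ℝ) : ℝ :=
  (a * (S - x) + (N - 1 : ℝ) * xi + alpha - v) / ((N - 1 : ℝ) * b + beta)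

/-- Quantity received by the deviator at the clearing price. -/
noncomputable def invQty (N : ℕ) (a xi b S x alpha beta v : ℝ) : ℝ :=
  alpha - beta * invPrice N a xi b S x alpha beta v

/-- The triple `(a, ξ, b)` has the best-response property: for every inventory
`x ∈ ℝ` and every schedule `(α, β) ∈ ℝ × (0, ∞)`, the expected utility
`E[−exp(−γ((x + q)μ̃ − pq))]` (a Lebesgue integral of the nonnegative integrand
`exp(γ(pq − (x + q)μ̃))`, valued in `[−∞, 0)`) is maximized over `(α, β)` at
`(α, β) = (ax + ξ, b)`. -/
noncomputable def IsBestResponseTriple {Om : Type*} [MeasurableSpace Om]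
    (P : Measure Om) (N : ℕ) (gam S : ℝ) (muRV ut : Om → ℝ)
    (a xi b : ℝ) : Prop :=
  ∀ x alpha beta : ℝ, 0 < beta →
    (∫⁻ om, ENNReal.ofReal (Real.exp (gam *
        (invPrice N a xi b S x (a * x + xi) b (ut om)
            * invQty N a xi b S x (a * x + xi) b (ut om)
          - (x + invQty N a xi b S x (a * x + xi) b (ut om)) * muRV om))) ∂P) ≤
    (∫⁻ om, ENNReal.ofReal (Real.exp (gam *
        (invPrice N a xi b S x alpha beta (ut om)
            * invQty N a xi b S x alpha beta (ut om)
          - (x + invQty N a xi b S x alpha beta (ut om)) * muRV om))) ∂P)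

/-- Exponent of the conditional expected disutility of a market maker with inventory `x` who buys
`q` shares along the inverse residual supply `(d + q) / k`, for a payoff of mean `mu` and
variance `s`. -/
noncomputable def disutilityExponent (gam s mu k x q d : ℝ) : ℝ :=
  gam * ((d + q) / k * q - (x + q) * mu) + gam ^ 2 * s * (x + q) ^ 2 / 2

/-- The purchase minimizing `disutilityExponent`. -/
noncomputable def optimalPurchase (gam s mu k x d : ℝ) : ℝ :=
  (k * (mu - gam * s * x) - d) / (2 + k * gam * s)

lemma disutilityExponent_eq_add_sq {gam s mu k x q d : ℝ} (hk : k ≠ 0)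
    (h : 2 + k * gam * s ≠ 0) :
    disutilityExponent gam s mu k x q d =
      disutilityExponent gam s mu k x (optimalPurchase gam s mu k x d) d +
        gam * (1 / k + gam * s / 2) * (q - optimalPurchase gam s mu k x d) ^ 2 := by
  have hq : (2 + k * gam * s) * optimalPurchase gam s mu k x d =
      k * (mu - gam * s * x) - d := mul_div_cancel₀ _ h
  generalize optimalPurchase gam s mu k x d = r at hq ⊢
  unfold disutilityExponent
  field_simp
  linear_combination 2 * gam * (q - r) * hq

lemma disutilityExponent_optimalPurchase_le {gam s mu k x q d : ℝ} (hgam : 0 < gam) (hs : 0 < s)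
    (hk : 0 < k) :
    disutilityExponent gam s mu k x (optimalPurchase gam s mu k x d) d ≤
      disutilityExponent gam s mu k x q d := by
  rw [disutilityExponent_eq_add_sq (q := q) hk.ne' (by positivity)]
  exact le_add_of_nonneg_right (by positivity)

lemma eq_optimalPurchase {gam s mu k x q d : ℝ} (hgam : 0 < gam) (hs : 0 < s) (hk : 0 < k)
    (h : disutilityExponent gam s mu k x q d =
      disutilityExponent gam s mu k x (optimalPurchase gam s mu k x d) d) :
    q = optimalPurchase gam s mu k x d := by
  rw [disutilityExponent_eq_add_sq (q := q) hk.ne' (by positivity), add_eq_left] at h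
  have hA : gam * (1 / k + gam * s / 2) ≠ 0 := by positivity
  exact sub_eq_zero.mp (pow_eq_zero_iff two_ne_zero |>.mp ((mul_eq_zero.mp h).resolve_left hA))

lemma lintegral_ofReal_exp_gaussianReal (mu : ℝ) (v : NNReal) (gam c y : ℝ) :
    ∫⁻ m, ENNReal.ofReal (Real.exp (gam * (c - y * m))) ∂gaussianReal mu v =
      ENNReal.ofReal (Real.exp (gam * (c - y * mu) + gam ^ 2 * v * y ^ 2 / 2)) := by
  have hsplit : ∀ m : ℝ, Real.exp (gam * (c - y * m)) =
      Real.exp (gam * c) * Real.exp (-(gam * y) * m) := fun m ↦ by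
    rw [← Real.exp_add]; ring_nf
  have hmgf : ∫ m, Real.exp (-(gam * y) * m) ∂gaussianReal mu v =
      Real.exp (mu * -(gam * y) + v * (-(gam * y)) ^ 2 / 2) :=
    congrFun (mgf_id_gaussianReal (μ := mu) (v := v)) (-(gam * y))
  simp only [hsplit]
  rw [← ofReal_integral_eq_lintegral_ofReal
    ((integrable_exp_mul_gaussianReal _).const_mul _)
    (Filter.Eventually.of_forall fun m ↦ by positivity), integral_const_mul, hmgf,
    ← Real.exp_add]
  ring_nf

lemma lintegral_ofReal_exp_of_indepFun {Om : Type*} [MeasurableSpace Om] {P : Measure Om}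
    [IsProbabilityMeasure P] {mu : ℝ} {v : NNReal} {muRV ut : Om → ℝ} (hmuRV : Measurable muRV)
    (hut : Measurable ut) (hgauss : P.map muRV = gaussianReal mu v) (hindep : IndepFun muRV ut P)
    (gam : ℝ) {c y : ℝ → ℝ} (hc : Measurable c) (hy : Measurable y) :
    ∫⁻ om, ENNReal.ofReal (Real.exp (gam * (c (ut om) - y (ut om) * muRV om))) ∂P =
      ∫⁻ om, ENNReal.ofReal (Real.exp
        (gam * (c (ut om) - y (ut om) * mu) + gam ^ 2 * v * y (ut om) ^ 2 / 2)) ∂P := by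
  have hF : Measurable fun z : ℝ × ℝ ↦
      ENNReal.ofReal (Real.exp (gam * (c z.2 - y z.2 * z.1))) := by fun_prop
  have hprod := (indepFun_iff_map_prod_eq_prod_map_map hmuRV.aemeasurable
    hut.aemeasurable).mp hindep
  have := Measure.isProbabilityMeasure_map (μ := P) hut.aemeasurable
  calc
    _ = ∫⁻ z, ENNReal.ofReal (Real.exp (gam * (c z.2 - y z.2 * z.1)))
          ∂(P.map fun om ↦ (muRV om, ut om)) := (lintegral_map hF (hmuRV.prodMk hut)).symm
    _ = ∫⁻ w, ENNReal.ofReal (Real.exp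
          (gam * (c w - y w * mu) + gam ^ 2 * v * y w ^ 2 / 2)) ∂(P.map ut) := by
      rw [hprod, hgauss, lintegral_prod_symm _ hF.aemeasurable]
      simp only [lintegral_ofReal_exp_gaussianReal]
    _ = _ := lintegral_map (by fun_prop) hut

lemma invPrice_eq {N : ℕ} {a xi b S x alpha beta v : ℝ} (hk : (N - 1 : ℝ) * b ≠ 0)
    (hd : (N - 1 : ℝ) * b + beta ≠ 0) :
    invPrice N a xi b S x alpha beta v =
      (a * (S - x) + (N - 1 : ℝ) * xi - v + invQty N a xi b S x alpha beta v) /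
        ((N - 1 : ℝ) * b) := by
  unfold invQty invPrice
  generalize (N - 1 : ℝ) * b = k at *
  field_simp
  ring

lemma invQty_eq {N : ℕ} {a xi b S x alpha beta v : ℝ} (hd : (N - 1 : ℝ) * b + beta ≠ 0) :
    invQty N a xi b S x alpha beta v =
      ((N - 1 : ℝ) * b * alpha - beta * (a * (S - x) + (N - 1 : ℝ) * xi - v)) /
        ((N - 1 : ℝ) * b + beta) := by
  unfold invQty invPrice
  field_simp
  ring

/-- The schedule that attains the pointwise optimal purchase in every state. -/
lemma invQty_eq_optimalPurchase {N : ℕ} {gam s mu a xi b S x v : ℝ} (hgam : 0 < gam) (hs : 0 < s)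
    (hk : 0 < (N - 1 : ℝ) * b) :
    invQty N a xi b S x
        ((N - 1 : ℝ) * b / (1 + (N - 1 : ℝ) * b * gam * s) * (mu - gam * s * x))
        ((N - 1 : ℝ) * b / (1 + (N - 1 : ℝ) * b * gam * s)) v =
      optimalPurchase gam s mu ((N - 1 : ℝ) * b) x (a * (S - x) + (N - 1 : ℝ) * xi - v) := by
  rw [invQty_eq (by positivity), optimalPurchase]
  generalize (N - 1 : ℝ) * b = k at *
  field_simp
  ring

/-- Agreement of the submitted purchase with the pointwise optimal one in two distinct states
pins down the schedule. -/
lemma eq_of_invQty_eq_optimalPurchase {N : ℕ} {gam s mu a xi b S x alpha beta v w : ℝ}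
    (hgam : 0 < gam) (hs : 0 < s) (hk : 0 < (N - 1 : ℝ) * b) (hbeta : 0 < beta) (hvw : v ≠ w)
    (hv : invQty N a xi b S x alpha beta v =
      optimalPurchase gam s mu ((N - 1 : ℝ) * b) x (a * (S - x) + (N - 1 : ℝ) * xi - v))
    (hw : invQty N a xi b S x alpha beta w =
      optimalPurchase gam s mu ((N - 1 : ℝ) * b) x (a * (S - x) + (N - 1 : ℝ) * xi - w)) :
    beta * (1 + (N - 1 : ℝ) * b * gam * s) = (N - 1 : ℝ) * b ∧
      alpha = beta * (mu - gam * s * x) := by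
  have h2 : 0 < 2 + (N - 1 : ℝ) * b * gam * s := by positivity
  have hd : 0 < (N - 1 : ℝ) * b + beta := by positivity
  rw [invQty_eq hd.ne', optimalPurchase, div_eq_div_iff hd.ne' h2.ne'] at hv hw
  generalize a * (S - x) + (N - 1 : ℝ) * xi = c at *
  generalize (N - 1 : ℝ) * b = k at *
  have hbeta' : beta * (1 + k * gam * s) = k :=
    mul_left_cancel₀ (sub_ne_zero.mpr hvw) (by linear_combination hv - hw)
  refine ⟨hbeta', ?_⟩
  have h : k * (2 + k * gam * s) ≠ 0 := by positivity
  apply mul_left_cancel₀ h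
  linear_combination hv + (c - v - k * (mu - gam * s * x)) * hbeta'

lemma exists_ne_of_ae {Om : Type*} [MeasurableSpace Om] {P : Measure Om} [NeZero P]
    {ut : Om → ℝ} (hnc : ¬ ∃ c : ℝ, ∀ᵐ om ∂P, ut om = c) {p : ℝ → Prop}
    (hp : ∀ᵐ om ∂P, p (ut om)) : ∃ v w, v ≠ w ∧ p v ∧ p w := by
  obtain ⟨om, hom⟩ := hp.exists
  by_contra! h
  refine hnc ⟨ut om, hp.mono fun om' hom' ↦ ?_⟩
  by_contra hne
  exact h _ _ hne hom' hom

/-- The expected disutility, integrated over the payoff. -/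
lemma lintegral_disutility {Om : Type*} [MeasurableSpace Om] {P : Measure Om}
    [IsProbabilityMeasure P] {mu s : ℝ} (hs : 0 < s) {muRV ut : Om → ℝ}
    (hmuRV : Measurable muRV) (hut : Measurable ut)
    (hgauss : P.map muRV = gaussianReal mu s.toNNReal) (hindep : IndepFun muRV ut P)
    (gam : ℝ) {N : ℕ} {a xi b S x alpha beta : ℝ} (hk : 0 < (N - 1 : ℝ) * b) (hbeta : 0 < beta) :
    ∫⁻ om, ENNReal.ofReal (Real.exp (gam *
        (invPrice N a xi b S x alpha beta (ut om) * invQty N a xi b S x alpha beta (ut om)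
          - (x + invQty N a xi b S x alpha beta (ut om)) * muRV om))) ∂P =
      ∫⁻ om, ENNReal.ofReal (Real.exp (disutilityExponent gam s mu ((N - 1 : ℝ) * b) x
        (invQty N a xi b S x alpha beta (ut om))
        (a * (S - x) + (N - 1 : ℝ) * xi - ut om))) ∂P := by
  have hq : Measurable fun v ↦ invQty N a xi b S x alpha beta v := by
    unfold invQty invPrice; fun_prop
  have hp : Measurable fun v ↦ invPrice N a xi b S x alpha beta v := by
    unfold invPrice; fun_prop
  refine (lintegral_ofReal_exp_of_indepFun hmuRV hut hgauss hindep gam (hp.mul hq)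
    (hq.const_add x)).trans ?_
  have hd : (N - 1 : ℝ) * b + beta ≠ 0 := by positivity
  simp only [Pi.mul_apply, invPrice_eq hk.ne' hd, disutilityExponent, Real.coe_toNNReal s hs.le]

lemma isBestResponseTriple_iff {Om : Type*} [MeasurableSpace Om] {P : Measure Om}
    [IsProbabilityMeasure P] {N : ℕ} {gam s mu S : ℝ} (hgam : 0 < gam) (hs : 0 < s)
    {muRV ut : Om → ℝ} (hmuRV : Measurable muRV) (hut : Measurable ut)
    (hgauss : P.map muRV = gaussianReal mu s.toNNReal) (hindep : IndepFun muRV ut P)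
    (hnc : ¬ ∃ c : ℝ, ∀ᵐ om ∂P, ut om = c) {a xi b : ℝ} (hb : 0 < b)
    (hk : 0 < (N - 1 : ℝ) * b) :
    IsBestResponseTriple P N gam S muRV ut a xi b ↔
      ∀ x, b * (1 + (N - 1 : ℝ) * b * gam * s) = (N - 1 : ℝ) * b ∧
        a * x + xi = b * (mu - gam * s * x) := by
  constructor
  · intro h x
    have hle := h x ((N - 1 : ℝ) * b / (1 + (N - 1 : ℝ) * b * gam * s) * (mu - gam * s * x))
      ((N - 1 : ℝ) * b / (1 + (N - 1 : ℝ) * b * gam * s)) (by positivity)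
    rw [lintegral_disutility hs hmuRV hut hgauss hindep gam hk hb,
      lintegral_disutility hs hmuRV hut hgauss hindep gam hk (by positivity)] at hle
    simp only [invQty_eq_optimalPurchase hgam hs hk] at hle
    have hfin : ∫⁻ om, ENNReal.ofReal (Real.exp (disutilityExponent gam s mu ((N - 1 : ℝ) * b) x
        (optimalPurchase gam s mu ((N - 1 : ℝ) * b) x (a * (S - x) + (N - 1 : ℝ) * xi - ut om))
        (a * (S - x) + (N - 1 : ℝ) * xi - ut om))) ∂P ≠ ⊤ := by
      have hbound : ∀ om, ENNReal.ofReal (Real.exp (disutilityExponent gam s mu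
          ((N - 1 : ℝ) * b) x
          (optimalPurchase gam s mu ((N - 1 : ℝ) * b) x
            (a * (S - x) + (N - 1 : ℝ) * xi - ut om))
          (a * (S - x) + (N - 1 : ℝ) * xi - ut om))) ≤
          ENNReal.ofReal (Real.exp (disutilityExponent gam s mu ((N - 1 : ℝ) * b) x 0 0)) := by
        intro om
        gcongr
        refine (disutilityExponent_optimalPurchase_le (q := 0) hgam hs hk).trans_eq ?_
        simp [disutilityExponent]
      refine ((lintegral_mono hbound).trans_lt ?_).ne
      simp
    have hae := ae_eq_of_ae_le_of_lintegral_le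
      (Filter.Eventually.of_forall fun om ↦ ENNReal.ofReal_le_ofReal
        (Real.exp_le_exp.mpr (disutilityExponent_optimalPurchase_le
          (q := invQty N a xi b S x (a * x + xi) b (ut om)) hgam hs hk)))
      hfin (Measurable.aemeasurable (by
        unfold disutilityExponent invQty invPrice; fun_prop)) hle
    obtain ⟨v, w, hvw, hv, hw⟩ := exists_ne_of_ae hnc
      (p := fun v ↦ invQty N a xi b S x (a * x + xi) b v =
        optimalPurchase gam s mu ((N - 1 : ℝ) * b) x (a * (S - x) + (N - 1 : ℝ) * xi - v))
      (hae.mono fun om hom ↦ by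
        refine eq_optimalPurchase hgam hs hk (Real.exp_injective ?_)
        exact ((ENNReal.ofReal_eq_ofReal_iff (Real.exp_pos _).le (Real.exp_pos _).le).mp hom).symm)
    exact eq_of_invQty_eq_optimalPurchase hgam hs hk hb hvw hv hw
  · intro h x alpha beta hbeta
    obtain ⟨h1, h2⟩ := h x
    rw [lintegral_disutility hs hmuRV hut hgauss hindep gam hk hb,
      lintegral_disutility hs hmuRV hut hgauss hindep gam hk hbeta]
    refine lintegral_mono fun om ↦ ENNReal.ofReal_le_ofReal (Real.exp_le_exp.mpr ?_)
    have hopt := invQty_eq_optimalPurchase (a := a) (xi := xi) (S := S) (x := x) (v := ut om)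
      (mu := mu) hgam hs hk
    rw [← eq_div_of_mul_eq (by positivity) h1, ← h2] at hopt
    rw [hopt]
    exact disutilityExponent_optimalPurchase_le hgam hs hk

/-- In the one-period demand-schedule game with inventories (`N ≥ 3`, `γ, σ > 0`,
`μ̃ ∼ N(μ, σ²)`, `ũ` independent of `μ̃` and not a.s. constant), there is a unique
triple `(a, ξ, b) ∈ ℝ × ℝ × (0, ∞)` with the best-response property, namely
`b = (N−2)/((N−1)γσ²)`, `a = −bγσ²`, `ξ = bμ`.  Under the corresponding linear
symmetric profile the clearing price is
`p = μ − (γσ²/N)S − ((N−1)/(N(N−2)))γσ²ũ` and market maker `n`'s trade is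
`qⁿ = −((N−2)/(N−1))(Xⁿ − S/N) + ũ/N`, where `Xⁿ` is her initial inventory. -/
theorem stmt_8 {Om : Type*} [MeasurableSpace Om] (P : Measure Om)
    [IsProbabilityMeasure P] (N : ℕ) (hN : 3 ≤ N)
    (gam sig : ℝ) (hgam : 0 < gam) (hsig : 0 < sig) (mu S : ℝ)
    (muRV ut : Om → ℝ) (hmuRV : Measurable muRV) (hut : Measurable ut)
    (hgauss : P.map muRV = gaussianReal mu (Real.toNNReal (sig ^ 2)))
    (hindep : IndepFun muRV ut P)
    (hnc : ¬ ∃ c : ℝ, ∀ᵐ om ∂P, ut om = c) :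
    (∀ a xi b : ℝ,
      (0 < b ∧ IsBestResponseTriple P N gam S muRV ut a xi b) ↔
        (b = (N - 2 : ℝ) / ((N - 1 : ℝ) * gam * sig ^ 2)
          ∧ a = -(((N - 2 : ℝ) / ((N - 1 : ℝ) * gam * sig ^ 2)) * gam * sig ^ 2)
          ∧ xi = ((N - 2 : ℝ) / ((N - 1 : ℝ) * gam * sig ^ 2)) * mu)) ∧
    -- the market-clearing price under the linear symmetric profile,
    -- `p = (aS + Nξ − ũ)/(Nb)`, equals the stated formula
    (∀ᵐ om ∂P,
      ((-(((N - 2 : ℝ) / ((N - 1 : ℝ) * gam * sig ^ 2)) * gam * sig ^ 2)) * S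
          + (N : ℝ) * (((N - 2 : ℝ) / ((N - 1 : ℝ) * gam * sig ^ 2)) * mu)
          - ut om)
        / ((N : ℝ) * ((N - 2 : ℝ) / ((N - 1 : ℝ) * gam * sig ^ 2)))
      = mu - gam * sig ^ 2 / N * S
          - ((N - 1 : ℝ) / ((N : ℝ) * (N - 2 : ℝ))) * gam * sig ^ 2 * ut om) ∧
    -- market maker `n`'s trade `qⁿ = aXⁿ + ξ − bp` equals the stated formula
    (∀ X : Fin N → ℝ, (∑ n, X n) = S → ∀ n : Fin N, ∀ᵐ om ∂P,
      (-(((N - 2 : ℝ) / ((N - 1 : ℝ) * gam * sig ^ 2)) * gam * sig ^ 2)) * X n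
          + ((N - 2 : ℝ) / ((N - 1 : ℝ) * gam * sig ^ 2)) * mu
          - ((N - 2 : ℝ) / ((N - 1 : ℝ) * gam * sig ^ 2))
            * (((-(((N - 2 : ℝ) / ((N - 1 : ℝ) * gam * sig ^ 2)) * gam * sig ^ 2)) * S
                + (N : ℝ) * (((N - 2 : ℝ) / ((N - 1 : ℝ) * gam * sig ^ 2)) * mu)
                - ut om)
              / ((N : ℝ) * ((N - 2 : ℝ) / ((N - 1 : ℝ) * gam * sig ^ 2))))
        = -((N - 2 : ℝ) / (N - 1 : ℝ)) * (X n - S / N) + ut om / N) := by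
  have hN3 : (3 : ℝ) ≤ N := by exact_mod_cast hN
  have hN0 : (N : ℝ) ≠ 0 := by linarith
  have hN1 : 0 < (N - 1 : ℝ) := by linarith
  have hN2 : 0 < (N - 2 : ℝ) := by linarith
  have hs : 0 < sig ^ 2 := by positivity
  refine ⟨fun a xi b ↦ ⟨?_, ?_⟩, Filter.Eventually.of_forall fun om ↦ ?_,
    fun X _ n ↦ Filter.Eventually.of_forall fun om ↦ ?_⟩
  · rintro ⟨hb, h⟩
    rw [isBestResponseTriple_iff hgam hs hmuRV hut hgauss hindep hnc hb (by positivity)] at h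
    have hb' : b = (N - 2 : ℝ) / ((N - 1 : ℝ) * gam * sig ^ 2) := by
      rw [eq_div_iff (by positivity)]
      exact mul_left_cancel₀ hb.ne' (by linear_combination (h 0).1)
    rw [← hb']
    exact ⟨rfl, by linear_combination (h 1).2 - (h 0).2, by linear_combination (h 0).2⟩
  · rintro ⟨hb, ha, hxi⟩
    rw [← hb] at ha hxi
    have hb0 : 0 < b := by rw [hb]; positivity
    refine ⟨hb0, ?_⟩
    rw [isBestResponseTriple_iff hgam hs hmuRV hut hgauss hindep hnc hb0 (by positivity)]
    rw [eq_div_iff (by positivity)] at hb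
    exact fun x ↦ ⟨by linear_combination b * hb, by rw [ha, hxi]; ring⟩
  · field_simp
    ring
  · field_simp
    ring
end

section
/- Fix ρ, γ₀, σ_D, ψ, φ > 0. For each integer N ≥ 3 define δ(N) := √(ρ² + 2(N−2)(ρ+ψ)(ρ+φ)) and PriceImpact(N) := γ₀·((N−1)/(N−2))·(ρσ_D²/((ρ+ψ)(ρ+φ)))·(1/δ(N) + 1/ρ) (this is the price impact with N market makers each of risk aversion γ = Nγ₀), and Liquidity(N) := 1/PriceImpact(N). Then N ↦ Liquidity(N) is strictly increasing on the integers N ≥ 3. -/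
/-- Fix `ρ, γ₀, σ_D, ψ, φ > 0`.  For each integer `N ≥ 3` let
`δ(N) := √(ρ² + 2(N−2)(ρ+ψ)(ρ+φ))`,
`PriceImpact(N) := γ₀·((N−1)/(N−2))·(ρσ_D²/((ρ+ψ)(ρ+φ)))·(1/δ(N) + 1/ρ)`
(the price impact with `N` market makers each of risk aversion `Nγ₀`) and
`Liquidity(N) := 1/PriceImpact(N)`.  Then `N ↦ Liquidity(N)` is strictly
increasing on the integers `N ≥ 3`. -/
theorem stmt_16 (rho gam0 sigD psi phi : ℝ)
    (hrho : 0 < rho) (hgam0 : 0 < gam0) (hsigD : 0 < sigD)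
    (hpsi : 0 < psi) (hphi : 0 < phi) :
    ∀ m n : ℕ, 3 ≤ m → m < n →
      1 / (gam0 * ((m - 1 : ℝ) / (m - 2 : ℝ))
          * (rho * sigD ^ 2 / ((rho + psi) * (rho + phi)))
          * (1 / Real.sqrt (rho ^ 2 + 2 * (m - 2 : ℝ) * (rho + psi) * (rho + phi))
            + 1 / rho)) <
      1 / (gam0 * ((n - 1 : ℝ) / (n - 2 : ℝ))
          * (rho * sigD ^ 2 / ((rho + psi) * (rho + phi)))
          * (1 / Real.sqrt (rho ^ 2 + 2 * (n - 2 : ℝ) * (rho + psi) * (rho + phi))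
            + 1 / rho)) := by
  intro m n hm hmn
  have hm3 : (3 : ℝ) ≤ m := by exact_mod_cast hm
  have hlt : (m : ℝ) < n := by exact_mod_cast hmn
  have hm2 : (0 : ℝ) < m - 2 := by linarith
  have hn1 : (0 : ℝ) < n - 1 := by linarith
  have hn2 : (0 : ℝ) < n - 2 := by linarith
  have hratio : (n - 1 : ℝ) / (n - 2 : ℝ) < (m - 1 : ℝ) / (m - 2 : ℝ) := by
    rw [div_lt_div_iff₀ hn2 hm2]
    nlinarith
  have hsqrt : Real.sqrt (rho ^ 2 + 2 * (m - 2 : ℝ) * (rho + psi) * (rho + phi)) ≤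
      Real.sqrt (rho ^ 2 + 2 * (n - 2 : ℝ) * (rho + psi) * (rho + phi)) := by
    gcongr
  have hpos : 0 < Real.sqrt (rho ^ 2 + 2 * (m - 2 : ℝ) * (rho + psi) * (rho + phi)) := by
    positivity
  have hinv := one_div_le_one_div_of_le hpos hsqrt
  apply one_div_lt_one_div_of_lt
  · positivity
  · apply mul_lt_mul
    · gcongr
    · gcongr
    · positivity
    · have : (0 : ℝ) < m - 1 := by linarith
      positivity
end

section
/- Fix an integer N ≥ 3 and ρ, γ, σ_D, φ > 0. For ψ > 0 define δ(ψ) := √(ρ² + 2(N−2)(ρ+ψ)(ρ+φ)) and PriceImpact(ψ) := (γ/N)·((N−1)/(N−2))·(ρσ_D²/((ρ+ψ)(ρ+φ)))·(1/δ(ψ) + 1/ρ), and Liquidity(ψ) := 1/PriceImpact(ψ). Then ψ ↦ Liquidity(ψ) is strictly increasing on (0, ∞). -/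
/-- For `N ≥ 3` and `ρ, γ, σ_D, φ > 0`, with
`δ(ψ) := √(ρ² + 2(N−2)(ρ+ψ)(ρ+φ))`,
`PriceImpact(ψ) := (γ/N)·((N−1)/(N−2))·(ρσ_D²/((ρ+ψ)(ρ+φ)))·(1/δ(ψ) + 1/ρ)` and
`Liquidity(ψ) := 1/PriceImpact(ψ)`, the map `ψ ↦ Liquidity(ψ)` is strictly
increasing on `(0, ∞)`. -/
theorem stmt_17 (N : ℕ) (hN : 3 ≤ N) (rho gam sigD phi : ℝ)
    (hrho : 0 < rho) (hgam : 0 < gam) (hsigD : 0 < sigD) (hphi : 0 < phi) :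
    StrictMonoOn (fun psi : ℝ =>
        1 / ((gam / N) * ((N - 1 : ℝ) / (N - 2 : ℝ))
          * (rho * sigD ^ 2 / ((rho + psi) * (rho + phi)))
          * (1 / Real.sqrt (rho ^ 2 + 2 * (N - 2 : ℝ) * (rho + psi) * (rho + phi))
            + 1 / rho)))
      (Set.Ioi 0) := by
  intro a ha b hb hab
  have ha' : 0 < a := ha
  have hb' : 0 < b := hb
  have hN3 : (3 : ℝ) ≤ N := by exact_mod_cast hN
  have hN0 : (0 : ℝ) < N := by linarith
  have hN1 : (0 : ℝ) < N - 1 := by linarith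
  have hN2 : (0 : ℝ) < N - 2 := by linarith
  have hC : 0 < (gam / N) * ((N - 1 : ℝ) / (N - 2 : ℝ)) := by positivity
  have hden : (rho + a) * (rho + phi) < (rho + b) * (rho + phi) := by gcongr
  have hfactor : rho * sigD ^ 2 / ((rho + b) * (rho + phi))
      < rho * sigD ^ 2 / ((rho + a) * (rho + phi)) :=
    div_lt_div_of_pos_left (by positivity) (by positivity) hden
  have hsqrt : Real.sqrt (rho ^ 2 + 2 * (N - 2 : ℝ) * (rho + a) * (rho + phi))
      ≤ Real.sqrt (rho ^ 2 + 2 * (N - 2 : ℝ) * (rho + b) * (rho + phi)) := by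
    gcongr
  have hsqrt_pos : 0 < Real.sqrt (rho ^ 2 + 2 * (N - 2 : ℝ) * (rho + a) * (rho + phi)) :=
    Real.sqrt_pos.mpr (by positivity)
  have hrecip := one_div_le_one_div_of_le hsqrt_pos hsqrt
  refine one_div_lt_one_div_of_lt (by positivity) ?_
  exact mul_lt_mul (mul_lt_mul_of_pos_left hfactor hC) (by linarith)
    (by positivity) (by positivity)
end

section
/- Fix ρ, γ₀, σ_D, ψ, φ > 0. For each integer N ≥ 3 define δ(N) := √(ρ² + 2(N−2)(ρ+ψ)(ρ+φ)) and PriceImpact(N) := γ₀·((N−1)/(N−2))·(ρσ_D²/((ρ+ψ)(ρ+φ)))·(1/δ(N) + 1/ρ) (the price impact with N market makers each of risk aversion Nγ₀). Then PriceImpact(N) → γ₀σ_D²/((ρ+φ)(ρ+ψ)) as N → ∞. In particular, price impact does not vanish in the competitive limit. -/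
open Filter

/-- Fix `ρ, γ₀, σ_D, ψ, φ > 0`.  With `δ(N) := √(ρ² + 2(N−2)(ρ+ψ)(ρ+φ))` and
`PriceImpact(N) := γ₀·((N−1)/(N−2))·(ρσ_D²/((ρ+ψ)(ρ+φ)))·(1/δ(N) + 1/ρ)`
(the price impact with `N` market makers each of risk aversion `Nγ₀`), we have
`PriceImpact(N) → γ₀σ_D²/((ρ+φ)(ρ+ψ))` as `N → ∞`; in particular price impact
does not vanish in the competitive limit. -/
theorem stmt_18 (rho gam0 sigD psi phi : ℝ)
    (hrho : 0 < rho) (hgam0 : 0 < gam0) (hsigD : 0 < sigD)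
    (hpsi : 0 < psi) (hphi : 0 < phi) :
    Tendsto (fun N : ℕ =>
        gam0 * ((N - 1 : ℝ) / (N - 2 : ℝ))
          * (rho * sigD ^ 2 / ((rho + psi) * (rho + phi)))
          * (1 / Real.sqrt (rho ^ 2 + 2 * (N - 2 : ℝ) * (rho + psi) * (rho + phi))
            + 1 / rho))
      atTop (nhds (gam0 * sigD ^ 2 / ((rho + phi) * (rho + psi)))) ∧
    gam0 * sigD ^ 2 / ((rho + phi) * (rho + psi)) ≠ 0 := by
  have hshift : Tendsto (fun N : ℕ => (N - 2 : ℝ)) atTop atTop :=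
    tendsto_atTop_add_const_right _ _ tendsto_natCast_atTop_atTop
  have hratio : Tendsto (fun N : ℕ => (N - 1 : ℝ) / (N - 2 : ℝ)) atTop (nhds 1) := by
    have h : Tendsto (fun N : ℕ => 1 + (N - 2 : ℝ)⁻¹) atTop (nhds 1) := by
      simpa using (tendsto_inv_atTop_zero.comp hshift).const_add 1
    refine h.congr' ?_
    filter_upwards [hshift.eventually_gt_atTop 0] with N hN
    field_simp
    ring
  have hsqrt : Tendsto (fun N : ℕ =>
      1 / Real.sqrt (rho ^ 2 + 2 * (N - 2 : ℝ) * (rho + psi) * (rho + phi)))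
      atTop (nhds 0) := by
    have hpos : 0 < 2 * (rho + psi) * (rho + phi) := by positivity
    have h : Tendsto (fun N : ℕ => rho ^ 2 + 2 * (N - 2 : ℝ) * (rho + psi) * (rho + phi))
        atTop atTop :=
      (tendsto_atTop_add_const_left _ (rho ^ 2) (hshift.const_mul_atTop hpos)).congr
        fun N => by ring
    simpa only [one_div, Function.comp_def] using
      tendsto_inv_atTop_zero.comp (Real.tendsto_sqrt_atTop.comp h)
  refine ⟨?_, by positivity⟩
  have hlim : gam0 * sigD ^ 2 / ((rho + phi) * (rho + psi)) =
      gam0 * 1 * (rho * sigD ^ 2 / ((rho + psi) * (rho + phi))) * (0 + 1 / rho) := by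
    field_simp
    ring
  rw [hlim]
  exact ((hratio.const_mul gam0).mul_const _).mul (hsqrt.add_const _)
end
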